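/- arXiv:1808.06482 — 8 statements merged into one kernel-verified Lean document; each statement's English description precedes it below -/
import Mathlib

section
/- Let t ∈ ℝ with t ≠ 0 and t ≠ 1, and let q = (1-t) • p + t • r lie on the θ-geodesic through p and r. Then D(p‖r) = D(p‖q) + D(q‖r) + (t/(1-t)) * D_A(r,q). -/
open RealInnerProductSpace

/-- Canonical divergence `D(p‖q) = ψ p - ψ q - ⟪∇ψ q, p - q⟫`. -/
noncomputable def canonDiv {n : ℕ} (ψ : EuclideanSpace ℝ (Fin n) → ℝ)
    (p q : EuclideanSpace ℝ (Fin n)) : ℝ :=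
  ψ p - ψ q - ⟪gradient ψ q, p - q⟫

/-- Affine divergence `D_A(p,q) = ⟪∇ψ q - ∇ψ p, q - p⟫`. -/
noncomputable def affineDiv {n : ℕ} (ψ : EuclideanSpace ℝ (Fin n) → ℝ)
    (p q : EuclideanSpace ℝ (Fin n)) : ℝ :=
  ⟪gradient ψ q - gradient ψ p, q - p⟫

/-- Division lemma along the θ-geodesic. -/
theorem canonDiv_division_theta {n : ℕ} (ψ : EuclideanSpace ℝ (Fin n) → ℝ)
    (hψ : Differentiable ℝ ψ) (t : ℝ) (ht0 : t ≠ 0) (ht1 : t ≠ 1)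
    (p q r : EuclideanSpace ℝ (Fin n)) (hq : q = (1 - t) • p + t • r) :
    canonDiv ψ p r
      = canonDiv ψ p q + canonDiv ψ q r + (t / (1 - t)) * affineDiv ψ r q := by
  have hpq : p - q = (t / (1 - t)) • (q - r) := by
    have h1 : 1 - t ≠ 0 := sub_ne_zero.mpr ht1.symm
    have hqr : q - r = (1 - t) • (p - r) := by rw [hq]; module
    rw [hqr, smul_smul, div_mul_cancel₀ _ h1, hq]
    module
  have hthree : canonDiv ψ p r = canonDiv ψ p q + canonDiv ψ q r
      + ⟪gradient ψ q - gradient ψ r, p - q⟫ := by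
    simp only [canonDiv, inner_sub_left, inner_sub_right]
    ring
  rw [hthree, hpq, real_inner_smul_right, affineDiv]
end

section
/- Let t ∈ ℝ with t ≠ 0 and t ≠ 1, and let q = (1-t) • p + t • r lie on the θ-geodesic through p and r. Then D(r‖p) = D(q‖p) + D(r‖q) + ((1-t)/t) * D_A(q,p). -/
open RealInnerProductSpace

/-- Dual division lemma along the θ-geodesic. -/
theorem canonDiv_division_theta_dual {n : ℕ} (ψ : EuclideanSpace ℝ (Fin n) → ℝ)
    (hψ : Differentiable ℝ ψ) (t : ℝ) (ht0 : t ≠ 0) (ht1 : t ≠ 1)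
    (p q r : EuclideanSpace ℝ (Fin n)) (hq : q = (1 - t) • p + t • r) :
    canonDiv ψ r p
      = canonDiv ψ q p + canonDiv ψ r q + ((1 - t) / t) * affineDiv ψ q p := by
  have h : r - q = ((1 - t) / t) • (q - p) := by
    have hqp : q - p = t • (r - p) := by rw [hq]; module
    rw [hqp, smul_smul, div_mul_cancel₀ _ ht0, hq]
    module
  have hrp : r - p = (q - p) + (r - q) := by abel
  have hpq : gradient ψ p - gradient ψ q = -(gradient ψ q - gradient ψ p) := by abel
  unfold canonDiv affineDiv
  rw [hrp, h, hpq, ← neg_sub q p, inner_neg_neg]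
  simp only [inner_add_right, inner_sub_left, inner_smul_right]
  ring
end

section
/- If points p, q, r, s satisfy p + r = q + s, then the generalized expansion formulas for the sum of vectors hold: D_A(p,r) = D_A(p,q) + D_A(p,s) + 2 * ⟨q,s⟩_r and D_A(p,r) = D_A(r,q) + D_A(r,s) + 2 * ⟨q,s⟩_p. -/
open RealInnerProductSpace

/-- Generalized inner product `⟨q,r⟩_p`. -/
noncomputable def genInner {n : ℕ} (ψ : EuclideanSpace ℝ (Fin n) → ℝ)
    (p q r : EuclideanSpace ℝ (Fin n)) : ℝ :=
  (1 / 2) * (⟪q - p, gradient ψ r - gradient ψ p⟫ + ⟪r - p, gradient ψ q - gradient ψ p⟫)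

/-- Generalized expansion formulas for the sum of vectors. -/
theorem generalized_expansion_formula {n : ℕ} (ψ : EuclideanSpace ℝ (Fin n) → ℝ)
    (hψ : Differentiable ℝ ψ) (p q r s : EuclideanSpace ℝ (Fin n))
    (h : p + r = q + s) :
    affineDiv ψ p r = affineDiv ψ p q + affineDiv ψ p s + 2 * genInner ψ r q s ∧
    affineDiv ψ p r = affineDiv ψ r q + affineDiv ψ r s + 2 * genInner ψ p q s := by
  obtain rfl : p = q + s - r := eq_sub_of_add_eq h
  simp only [affineDiv, genInner, inner_sub_left, inner_sub_right, inner_add_right,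
    real_inner_comm (gradient ψ _)]
  constructor <;> ring
end

section
/- If points p, q, r, s satisfy p + r = q + s, then the generalized polarization identity holds: 2 * (⟨q,s⟩_p + ⟨q,s⟩_r) = D_A(p,r) - D_A(q,s). -/
open RealInnerProductSpace

/-- Generalized polarization identity. -/
theorem generalized_polarization_identity {n : ℕ} (ψ : EuclideanSpace ℝ (Fin n) → ℝ)
    (hψ : Differentiable ℝ ψ) (p q r s : EuclideanSpace ℝ (Fin n))
    (h : p + r = q + s) :
    2 * (genInner ψ p q s + genInner ψ r q s) = affineDiv ψ p r - affineDiv ψ q s := by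
  obtain rfl : r = q + s - p := eq_sub_of_add_eq' h
  simp only [genInner, affineDiv, inner_sub_left, inner_sub_right, inner_add_left,
    inner_add_right, real_inner_comm _ (gradient ψ _)]
  ring
end

section
/- If points p, q, r, s satisfy p + r = q + s, then ⟨q,s⟩_p + ⟨q,s⟩_r + ⟨p,r⟩_q + ⟨p,r⟩_s = 0 (a generalization of the fact that adjacent interior angles of a parallelogram sum to π). -/
open RealInnerProductSpace

/-- The sum of the four generalized interior-angle inner products of a parallelogram vanishes. -/
theorem generalized_interior_angles {n : ℕ} (ψ : EuclideanSpace ℝ (Fin n) → ℝ)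
    (hψ : Differentiable ℝ ψ) (p q r s : EuclideanSpace ℝ (Fin n))
    (h : p + r = q + s) :
    genInner ψ p q s + genInner ψ r q s + genInner ψ q p r + genInner ψ s p r = 0 := by
  obtain rfl : r = q + s - p := eq_sub_of_add_eq' h
  simp only [genInner, inner_sub_left, inner_sub_right, inner_add_left]
  ring
end

section
/- Let ψ be strictly convex and differentiable and let α ∈ (0,1). Then the affine divergence dominates the α-skew ψ-divergence: α * (1-α) * D_A(p,q) ≥ (1-α) * ψ p + α * ψ q - ψ ((1-α) • p + α • q) for all p, q. -/
open RealInnerProductSpace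

/-- A convex function lies above its tangent hyperplanes. -/
theorem ConvexOn.add_inner_gradient_le {F : Type*} [NormedAddCommGroup F]
    [InnerProductSpace ℝ F] [CompleteSpace F] {f : F → ℝ} {s : Set F} (hf : ConvexOn ℝ s f)
    {x y : F} (hx : x ∈ s) (hy : y ∈ s) (hd : DifferentiableAt ℝ f x) :
    f x + ⟪gradient f x, y - x⟫ ≤ f y := by
  have hline : HasDerivAt (f ∘ AffineMap.lineMap (k := ℝ) x y) ⟪gradient f x, y - x⟫ 0 := by
    have hf' : HasFDerivAt f (InnerProductSpace.toDual ℝ F (gradient f x))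
        (AffineMap.lineMap (k := ℝ) x y 0) := by
      simpa using hd.hasGradientAt.hasFDerivAt
    simpa using hf'.comp_hasDerivAt (0 : ℝ) AffineMap.hasDerivAt_lineMap
  have h := (hf.comp_affineMap (AffineMap.lineMap (k := ℝ) x y)).le_slope_of_hasDerivAt
    (x := 0) (y := 1) (by simpa using hx) (by simpa using hy) zero_lt_one hline
  simp only [slope_def_field, Function.comp_apply, AffineMap.lineMap_apply_one,
    AffineMap.lineMap_apply_zero, sub_zero, div_one] at h
  linarith

/-- The affine divergence dominates the α-skew ψ-divergence (Jensen gap). -/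
theorem affineDiv_dominates_skew_psi_divergence {n : ℕ}
    (ψ : EuclideanSpace ℝ (Fin n) → ℝ) (hψ : Differentiable ℝ ψ)
    (hconv : StrictConvexOn ℝ Set.univ ψ) (α : ℝ) (hα : α ∈ Set.Ioo (0 : ℝ) 1)
    (p q : EuclideanSpace ℝ (Fin n)) :
    α * (1 - α) * affineDiv ψ p q
      ≥ (1 - α) * ψ p + α * ψ q - ψ ((1 - α) • p + α • q) := by
  obtain ⟨hα₀, hα₁⟩ := hα
  have tangent (x y : EuclideanSpace ℝ (Fin n)) : ψ x + ⟪gradient ψ x, y - x⟫ ≤ ψ y :=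
    hconv.convexOn.add_inner_gradient_le (Set.mem_univ x) (Set.mem_univ y) (hψ x)
  have hp := tangent p ((1 - α) • p + α • q)
  have hq := tangent q ((1 - α) • p + α • q)
  rw [show (1 - α) • p + α • q - p = α • (q - p) by module, real_inner_smul_right] at hp
  rw [show (1 - α) • p + α • q - q = (α - 1) • (q - p) by module, real_inner_smul_right] at hq
  rw [affineDiv, inner_sub_left]
  linear_combination (1 - α) * hp + α * hq
end

section
/- Generalized Lin's inequality for the Jensen–Shannon divergence: for strictly positive probability vectors p, q on Fin n and α ∈ (0,1), α * (1-α) * (KL(p‖q) + KL(q‖p)) ≥ (1-α) * KL(p‖m) + α * KL(q‖m), where m i = (1-α) * p i + α * q i; the case α = 1/2 is Lin's inequality between the Jeffreys divergence and the Jensen–Shannon divergence. -/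
open Finset

/-- Kullback–Leibler divergence of finite probability vectors. -/
noncomputable def klDiv {n : ℕ} (p q : Fin n → ℝ) : ℝ :=
  ∑ i, p i * Real.log (p i / q i)

/-- Convexity of the Kullback–Leibler divergence in its second argument, along the segment
starting at the first argument. -/
theorem klDiv_mix_le {n : ℕ} {p q : Fin n → ℝ} (hp : ∀ i, 0 < p i) (hq : ∀ i, 0 < q i)
    {a b : ℝ} (ha : 0 < a) (hb : 0 < b) (hab : a + b = 1) :
    klDiv p (fun i => a * p i + b * q i) ≤ b * klDiv p q := by
  unfold klDiv
  rw [Finset.mul_sum]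
  refine Finset.sum_le_sum fun i _ => ?_
  have hm : 0 < a * p i + b * q i := add_pos (mul_pos ha (hp i)) (mul_pos hb (hq i))
  have hlog : a * Real.log (p i) + b * Real.log (q i) ≤ Real.log (a * p i + b * q i) := by
    simpa only [smul_eq_mul] using
      strictConcaveOn_log_Ioi.concaveOn.2 (hp i) (hq i) ha.le hb.le hab
  rw [Real.log_div (hp i).ne' hm.ne', Real.log_div (hp i).ne' (hq i).ne', mul_left_comm]
  refine mul_le_mul_of_nonneg_left ?_ (hp i).le
  obtain rfl : a = 1 - b := by linarith
  linarith

/-- Generalized Lin's inequality for the Jensen–Shannon divergence. -/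
theorem generalized_lin_inequality_JS {n : ℕ} (p q : Fin n → ℝ)
    (hp : ∀ i, 0 < p i) (hq : ∀ i, 0 < q i)
    (hp1 : ∑ i, p i = 1) (hq1 : ∑ i, q i = 1)
    (α : ℝ) (hα : α ∈ Set.Ioo (0 : ℝ) 1) :
    α * (1 - α) * (klDiv p q + klDiv q p)
      ≥ (1 - α) * klDiv p (fun i => (1 - α) * p i + α * q i)
          + α * klDiv q (fun i => (1 - α) * p i + α * q i) := by
  obtain ⟨h0, h1⟩ := hα
  have h1' : 0 < 1 - α := sub_pos.2 h1
  have hpq := mul_le_mul_of_nonneg_left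
    (klDiv_mix_le hp hq h1' h0 (sub_add_cancel 1 α)) h1'.le
  have hqp := mul_le_mul_of_nonneg_left
    (klDiv_mix_le hq hp h0 h1' (add_sub_cancel α 1)) h0.le
  simp only [add_comm (α * q _)] at hqp
  linarith
end

section
/- Generalized Lin's inequality for the Bhattacharyya distance: for strictly positive probability vectors p, q on Fin n and α ∈ (0,1), α * (1-α) * (KL(p‖q) + KL(q‖p)) ≥ -Real.log (∑ i, (p i) ^ (1-α) * (q i) ^ α), where the right-hand side is the α-skew Bhattacharyya distance. -/
open Finset

/-- The skew Bhattacharyya distance lies below its tangent line at `0`, by Jensen's inequality. -/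
theorem neg_log_sum_rpow_mul_rpow_le_mul_klDiv {n : ℕ} (p q : Fin n → ℝ)
    (hp : ∀ i, 0 < p i) (hq : ∀ i, 0 < q i) (hp1 : ∑ i, p i = 1) (α : ℝ) :
    -Real.log (∑ i, p i ^ (1 - α) * q i ^ α) ≤ α * klDiv p q := by
  have jensen := strictConcaveOn_log_Ioi.concaveOn.le_map_sum (t := Finset.univ) (w := p)
    (p := fun i => (q i / p i) ^ α) (fun i _ => (hp i).le) hp1
    (fun i _ => Real.rpow_pos_of_pos (div_pos (hq i) (hp i)) α)
  have hsum : ∑ i, p i • (q i / p i) ^ α = ∑ i, p i ^ (1 - α) * q i ^ α := by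
    refine Finset.sum_congr rfl fun i _ => ?_
    rw [Real.div_rpow (hq i).le (hp i).le, Real.rpow_sub (hp i), Real.rpow_one, smul_eq_mul]
    ring
  have hlog : ∑ i, p i • Real.log ((q i / p i) ^ α) = -(α * klDiv p q) := by
    rw [klDiv, Finset.mul_sum, ← Finset.sum_neg_distrib]
    refine Finset.sum_congr rfl fun i _ => ?_
    rw [Real.log_rpow (div_pos (hq i) (hp i)), Real.log_div (hq i).ne' (hp i).ne',
      Real.log_div (hp i).ne' (hq i).ne', smul_eq_mul]
    ring
  rw [hsum, hlog] at jensen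
  linarith

/-- Generalized Lin's inequality for the α-skew Bhattacharyya distance. -/
theorem generalized_lin_inequality_bhattacharyya {n : ℕ} (p q : Fin n → ℝ)
    (hp : ∀ i, 0 < p i) (hq : ∀ i, 0 < q i)
    (hp1 : ∑ i, p i = 1) (hq1 : ∑ i, q i = 1)
    (α : ℝ) (hα : α ∈ Set.Ioo (0 : ℝ) 1) :
    α * (1 - α) * (klDiv p q + klDiv q p)
      ≥ -Real.log (∑ i, p i ^ (1 - α) * q i ^ α) := by
  obtain ⟨h0, h1⟩ := hα
  have hpq := neg_log_sum_rpow_mul_rpow_le_mul_klDiv p q hp hq hp1 α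
  have hqp := neg_log_sum_rpow_mul_rpow_le_mul_klDiv q p hq hp hq1 (1 - α)
  simp only [sub_sub_cancel, mul_comm (q _ ^ α)] at hqp
  have hpq' := mul_le_mul_of_nonneg_left hpq (sub_pos.2 h1).le
  have hqp' := mul_le_mul_of_nonneg_left hqp h0.le
  linarith
end
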